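/- arXiv:2107.04411 — 2 statements merged into one kernel-verified Lean document; each statement's English description precedes it below -/
import Mathlib

section
/- The linear map Φ : ⊕_{(C,π)} End(V_{C,π}) → D(G), given on the (C,π)-summand by Φ(c ⊗ e_i ⊗ δ_d ⊗ f^j) = (dim V_π / |C_G|) Σ_{n ∈ C_G} π(n⁻¹)_{ji} · (δ_c ⊗ q_c n q_d⁻¹), where the direct sum runs over one representative conjugacy class datum (C, r_C, q) for each conjugacy class and a complete set of pairwise non-isomorphic irreducible complex representations π of C_G(r_C), is an isomorphism of D(G)-bimodules (D(G) acting on itself by left and right multiplication). -/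
/-!
The Peter–Weyl map `Φ : ⊕_{(C,π)} End(V_{C,π}) → D(G)` is an isomorphism of
`D(G)`-bimodules, where `D(G)` acts on itself by left and right multiplication.
-/

noncomputable section

open scoped BigOperators Classical

set_option linter.unusedSectionVars false

/-- The quantum double `D(G)` as a vector space: the value at `(s, h)` is the
coefficient of the basis element `δ_s ⊗ h`. -/
abbrev DoubleDG (G : Type*) := G × G → ℂ

/-- The basis element `δ_s ⊗ h` of `D(G)`. -/
def DGbasis {G : Type*} [DecidableEq G] (s h : G) : DoubleDG G :=
  fun p => if p = (s, h) then 1 else 0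

/-- The multiplication of `D(G)`, determined by
`(δ_s ⊗ h)(δ_t ⊗ g) = [s = hth⁻¹] (δ_s ⊗ hg)`. -/
def DGmul {G : Type*} [Group G] [Fintype G] (x y : DoubleDG G) : DoubleDG G :=
  fun p => ∑ h : G, x (p.1, h) * y (h⁻¹ * p.1 * h, h⁻¹ * p.2)

/-- The unit `Σ_s δ_s ⊗ e` of `D(G)`. -/
def DGone {G : Type*} [Group G] [DecidableEq G] : DoubleDG G :=
  fun p => if p.2 = 1 then 1 else 0

/-- The antipode of `D(G)`: `S(δ_g ⊗ h) = δ_{h⁻¹g⁻¹h} ⊗ h⁻¹`. -/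
def DGantipode {G : Type*} [Group G] (x : DoubleDG G) : DoubleDG G :=
  fun p => x (p.2⁻¹ * p.1⁻¹ * p.2, p.2⁻¹)

variable {G : Type*} [Group G] [Fintype G] [DecidableEq G]

/-- The conjugacy class of `r`, as a subtype. -/
abbrev ConjCl (r : G) := {x : G // IsConj r x}

lemma isConj_conj_right {r c : G} (hc : IsConj r c) (h : G) :
    IsConj r (h⁻¹ * c * h) := by
  obtain ⟨g, hg⟩ := isConj_iff.1 hc
  refine isConj_iff.2 ⟨h⁻¹ * g, ?_⟩
  rw [← hg]; group

/-- The cocycle `ζ_c(g) = q_{g c g⁻¹}⁻¹ * g * q_c`. -/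
def zeta {G : Type*} [Group G] (q : G → G) (c g : G) : G :=
  (q (g * c * g⁻¹))⁻¹ * g * q c

variable {W : Type*} [AddCommGroup W] [Module ℂ W]

/-- The action of the basis element `δ_s ⊗ h` of `D(G)` on `V_{C,π} = ℂC ⊗ V_π`,
realised as `C → V_π`: on the basis vector `c ⊗ w` it is
`(δ_s ⊗ h) ▷ (c ⊗ w) = [s = hch⁻¹] (hch⁻¹ ⊗ π(ζ_c(h)) w)`. -/
def siteAct (r : G) (q : G → G) (π : G → Module.End ℂ W) (s h : G) :
    Module.End ℂ (ConjCl r → W) where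
  toFun v := fun c =>
    if (c : G) = s then
      π (zeta q (h⁻¹ * c * h) h) (v ⟨h⁻¹ * c * h, isConj_conj_right c.2 h⟩)
    else 0
  map_add' v w := by
    funext c
    by_cases hcs : (c : G) = s <;> simp [hcs]
  map_smul' a v := by
    funext c
    by_cases hcs : (c : G) = s <;> simp [hcs]

/-- The linear extension of the site action to all of `D(G)`. -/
def rep (r : G) (q : G → G) (π : G → Module.End ℂ W) (x : DoubleDG G) :
    Module.End ℂ (ConjCl r → W) :=
  ∑ s : G, ∑ h : G, x (s, h) • siteAct r q π s h

/-- The component of the Peter–Weyl map on `End(V_{C,π})`: on rank-one operators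
`v ⊗ φ` it restricts to
`Φ(c ⊗ e_i ⊗ δ_d ⊗ f^j) = (dim V_π/|C_G|) Σ_{n∈C_G} π(n⁻¹)_{ji} δ_c ⊗ q_c n q_d⁻¹`,
expressed basis-freely using the trace. -/
def PhiEnd (r : G) (q : G → G) (π : G → Module.End ℂ W) [FiniteDimensional ℂ W]
    (L : Module.End ℂ (ConjCl r → W)) : DoubleDG G :=
  fun p =>
    ((Module.finrank ℂ W : ℂ) /
        ((Finset.univ.filter fun n : G => n * r = r * n).card : ℂ)) *
      ∑ d : G, ∑ n : G,
        if hcond : IsConj r p.1 ∧ IsConj r d ∧ n * r = r * n ∧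
            p.2 = q p.1 * n * (q d)⁻¹ then
          LinearMap.trace ℂ (ConjCl r → W)
            ((LinearMap.single ℂ (fun _ : ConjCl r => W) ⟨d, hcond.2.1⟩) ∘ₗ
              (π n⁻¹) ∘ₗ (LinearMap.proj (⟨p.1, hcond.1⟩ : ConjCl r)) ∘ₗ L)
        else 0

/-- The centralizer of `r`, as a finite set. -/
def centralizerFinset (r : G) : Finset G := Finset.univ.filter fun n => n * r = r * n

lemma mem_centralizerFinset {r n : G} : n ∈ centralizerFinset r ↔ n * r = r * n := by
  simp [centralizerFinset]

lemma mul_mem_centralizerFinset {r m n : G} (hm : m ∈ centralizerFinset r)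
    (hn : n ∈ centralizerFinset r) : m * n ∈ centralizerFinset r := by
  rw [mem_centralizerFinset] at *
  rw [mul_assoc, hn, ← mul_assoc, hm, mul_assoc]

lemma inv_mem_centralizerFinset {r n : G} (hn : n ∈ centralizerFinset r) :
    n⁻¹ ∈ centralizerFinset r := by
  rw [mem_centralizerFinset] at *
  rw [inv_mul_eq_iff_eq_mul, ← mul_assoc, hn, mul_inv_cancel_right]

lemma one_mem_centralizerFinset (r : G) : 1 ∈ centralizerFinset r := by
  simp [mem_centralizerFinset]

lemma card_centralizerFinset_ne_zero (r : G) : ((centralizerFinset r).card : ℂ) ≠ 0 := by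
  have := Finset.card_ne_zero_of_mem (one_mem_centralizerFinset r)
  exact_mod_cast this

/-- `π` restricts to a representation of the centralizer of `r` whose only invariant subspaces
are `⊥` and `⊤`. -/
structure IsCentralizerIrrep (r : G) (π : G → Module.End ℂ W) : Prop where
  one : π 1 = 1
  mul : ∀ m n : G, m * r = r * m → n * r = r * n → π (m * n) = π m * π n
  irr : ∀ U : Submodule ℂ W, (∀ n : G, n * r = r * n → ∀ w ∈ U, π n w ∈ U) → U = ⊥ ∨ U = ⊤

section Schur

variable {W' : Type*} [AddCommGroup W'] [Module ℂ W'] {r : G}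
  {π : G → Module.End ℂ W} {ρ : G → Module.End ℂ W'}

lemma IsCentralizerIrrep.eq_zero_or_bijective (hπ : IsCentralizerIrrep r π)
    (hρ : IsCentralizerIrrep r ρ) (T : W →ₗ[ℂ] W')
    (hT : ∀ n, n * r = r * n → ∀ w, T (π n w) = ρ n (T w)) :
    T = 0 ∨ Function.Bijective T := by
  rcases hπ.irr (LinearMap.ker T) (fun n hn w hw => by
    rw [LinearMap.mem_ker] at *; rw [hT n hn, hw, map_zero]) with h | h
  · rcases hρ.irr (LinearMap.range T) (by
      rintro n hn _ ⟨w, rfl⟩; exact ⟨π n w, hT n hn w⟩) with h' | h'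
    · exact .inl (LinearMap.range_eq_bot.1 h')
    · exact .inr ⟨LinearMap.ker_eq_bot.1 h, LinearMap.range_eq_top.1 h'⟩
  · exact .inl (LinearMap.ker_eq_top.1 h)

lemma IsCentralizerIrrep.exists_eq_smul [FiniteDimensional ℂ W] (hπ : IsCentralizerIrrep r π)
    (T : Module.End ℂ W) (hT : ∀ n, n * r = r * n → ∀ w, T (π n w) = π n (T w)) :
    ∃ μ : ℂ, T = μ • 1 := by
  rcases subsingleton_or_nontrivial W with h | h
  · exact ⟨0, LinearMap.ext fun w => Subsingleton.elim _ _⟩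
  · obtain ⟨μ, hμ⟩ := Module.End.exists_eigenvalue T
    refine ⟨μ, ?_⟩
    rcases hπ.irr (Module.End.eigenspace T μ) (fun n hn w hw => by
      rw [Module.End.mem_eigenspace_iff] at *; rw [hT n hn, hw, map_smul]) with h | h
    · exact absurd h hμ
    · ext w
      have : w ∈ Module.End.eigenspace T μ := h ▸ Submodule.mem_top
      simpa using Module.End.mem_eigenspace_iff.1 this

/-- The intertwiner `Σ_n ρ(n) A π(n)⁻¹` obtained by averaging `A` over the centralizer. -/
def centralizerAverage (r : G) (π : G → Module.End ℂ W) (ρ : G → Module.End ℂ W')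
    (A : W →ₗ[ℂ] W') : W →ₗ[ℂ] W' :=
  ∑ n ∈ centralizerFinset r, ρ n ∘ₗ A ∘ₗ π n⁻¹

lemma centralizerAverage_apply (A : W →ₗ[ℂ] W') (w : W) :
    centralizerAverage r π ρ A w = ∑ n ∈ centralizerFinset r, ρ n (A (π n⁻¹ w)) := by
  simp [centralizerAverage, LinearMap.sum_apply]

lemma sum_centralizerFinset_mul_left {M : Type*} [AddCommMonoid M] {m : G}
    (hm : m ∈ centralizerFinset r) (f : G → M) :
    ∑ n ∈ centralizerFinset r, f (m * n) = ∑ n ∈ centralizerFinset r, f n :=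
  Finset.sum_bij' (fun n _ => m * n) (fun n _ => m⁻¹ * n)
    (fun _ hn => mul_mem_centralizerFinset hm hn)
    (fun _ hn => mul_mem_centralizerFinset (inv_mem_centralizerFinset hm) hn)
    (by simp) (by simp) (by simp)

lemma sum_centralizerFinset_inv {M : Type*} [AddCommMonoid M] (f : G → M) :
    ∑ n ∈ centralizerFinset r, f n⁻¹ = ∑ n ∈ centralizerFinset r, f n :=
  Finset.sum_bij' (fun n _ => n⁻¹) (fun n _ => n⁻¹)
    (fun _ hn => inv_mem_centralizerFinset hn) (fun _ hn => inv_mem_centralizerFinset hn)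
    (by simp) (by simp) (by simp)

lemma IsCentralizerIrrep.average_comm (hπ : IsCentralizerIrrep r π)
    (hρ : IsCentralizerIrrep r ρ) (A : W →ₗ[ℂ] W') (m : G) (hm : m * r = r * m) (w : W) :
    centralizerAverage r π ρ A (π m w) = ρ m (centralizerAverage r π ρ A w) := by
  rw [centralizerAverage_apply, centralizerAverage_apply, map_sum,
    ← sum_centralizerFinset_mul_left (mem_centralizerFinset.2 hm)]
  refine Finset.sum_congr rfl fun n hn => ?_
  have hn' := mem_centralizerFinset.1 hn
  have hmi := mem_centralizerFinset.1
    (inv_mem_centralizerFinset (mul_mem_centralizerFinset (mem_centralizerFinset.2 hm) hn))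
  rw [hρ.mul m n hm hn', ← Module.End.mul_apply (π _) (π m), ← hπ.mul _ _ hmi hm]
  simp

lemma IsCentralizerIrrep.average_eq [FiniteDimensional ℂ W] (hπ : IsCentralizerIrrep r π)
    (A : Module.End ℂ W) :
    (Module.finrank ℂ W : ℂ) • centralizerAverage r π π A =
      ((centralizerFinset r).card * LinearMap.trace ℂ W A) • 1 := by
  obtain ⟨μ, hμ⟩ := hπ.exists_eq_smul (centralizerAverage r π π A)
    (hπ.average_comm hπ A)
  have htr : LinearMap.trace ℂ W (centralizerAverage r π π A) =
      (centralizerFinset r).card * LinearMap.trace ℂ W A := by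
    rw [centralizerAverage, map_sum, Finset.sum_congr rfl (g := fun _ => LinearMap.trace ℂ W A),
      Finset.sum_const, nsmul_eq_mul]
    intro n hn
    have hn' := mem_centralizerFinset.1 hn
    have hi := mem_centralizerFinset.1 (inv_mem_centralizerFinset hn)
    change LinearMap.trace ℂ W (π n * (A * π n⁻¹)) = _
    rw [LinearMap.trace_mul_comm, mul_assoc, ← hπ.mul _ _ hi hn', inv_mul_cancel, hπ.one, mul_one]
  rw [hμ, map_smul, LinearMap.trace_one, smul_eq_mul] at htr
  rw [← htr, hμ, smul_smul, mul_comm]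

lemma trace_mul_eq_sum_coord [FiniteDimensional ℂ W] (A B : Module.End ℂ W) :
    LinearMap.trace ℂ W (A * B) =
      ∑ a, (Module.finBasis ℂ W).coord a (A (B (Module.finBasis ℂ W a))) := by
  rw [LinearMap.trace_eq_matrix_trace ℂ (Module.finBasis ℂ W), Matrix.trace]
  simp [LinearMap.toMatrix_apply]

lemma sum_trace_smul_apply [FiniteDimensional ℂ W] (B : Module.End ℂ W) (u : W') :
    (∑ n ∈ centralizerFinset r, LinearMap.trace ℂ W (π n⁻¹ * B) • ρ n) u =
      ∑ a, centralizerAverage r π ρ (((Module.finBasis ℂ W).coord a).smulRight u)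
        (B (Module.finBasis ℂ W a)) := by
  simp only [centralizerAverage_apply, LinearMap.sum_apply, trace_mul_eq_sum_coord,
    LinearMap.smulRight_apply, map_smul, LinearMap.smul_apply, Finset.sum_smul]
  rw [Finset.sum_comm]

lemma IsCentralizerIrrep.sum_trace_smul_eq_zero [FiniteDimensional ℂ W]
    (hπ : IsCentralizerIrrep r π) (hρ : IsCentralizerIrrep r ρ)
    (hne : ¬ ∃ f : W ≃ₗ[ℂ] W', ∀ n : G, n * r = r * n → ∀ w, f (π n w) = ρ n (f w))
    (B : Module.End ℂ W) :
    ∑ n ∈ centralizerFinset r, LinearMap.trace ℂ W (π n⁻¹ * B) • ρ n = 0 := by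
  ext u
  rw [sum_trace_smul_apply]
  refine Finset.sum_eq_zero fun a _ => ?_
  rcases hπ.eq_zero_or_bijective hρ _ (hπ.average_comm hρ _) with h | h
  · rw [h, LinearMap.zero_apply]
  · exact absurd ⟨LinearEquiv.ofBijective _ h, fun n hn w => hπ.average_comm hρ _ n hn w⟩ hne

lemma IsCentralizerIrrep.sum_trace_smul_eq [FiniteDimensional ℂ W]
    (hπ : IsCentralizerIrrep r π) (B : Module.End ℂ W) :
    ((Module.finrank ℂ W : ℂ) / ((centralizerFinset r).card : ℂ)) •
      ∑ n ∈ centralizerFinset r, LinearMap.trace ℂ W (π n⁻¹ * B) • π n = B := by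
  ext u
  rw [LinearMap.smul_apply, sum_trace_smul_apply, div_eq_inv_mul, mul_smul, Finset.smul_sum]
  simp_rw [← LinearMap.smul_apply, hπ.average_eq, LinearMap.trace_smulRight]
  simp_rw [LinearMap.smul_apply, mul_smul, Module.End.one_apply, ← Finset.smul_sum]
  rw [inv_smul_smul₀ (card_centralizerFinset_ne_zero r)]
  conv_rhs => rw [← (Module.finBasis ℂ W).sum_repr u, map_sum]
  simp

end Schur

section Completeness

variable {H : Type*} [Group H]

/-- The group algebra of a finite group is semisimple, so an element annihilating every simple
left ideal vanishes. -/
lemma MonoidAlgebra.eq_zero_of_smul_simple [Finite H] (α : MonoidAlgebra ℂ H)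
    (h : ∀ S : Submodule (MonoidAlgebra ℂ H) (MonoidAlgebra ℂ H),
      IsSimpleModule (MonoidAlgebra ℂ H) S → ∀ s ∈ S, α * s = 0) : α = 0 := by
  have htop := IsSemisimpleModule.sSup_simples_eq_top (MonoidAlgebra ℂ H) (MonoidAlgebra ℂ H)
  have h1 : (1 : MonoidAlgebra ℂ H) ∈
      sSup {m : Submodule (MonoidAlgebra ℂ H) (MonoidAlgebra ℂ H) |
        IsSimpleModule (MonoidAlgebra ℂ H) m} := htop ▸ Submodule.mem_top
  rw [sSup_eq_iSup'] at h1
  have := Submodule.iSup_induction _ (motive := fun x => α * x = 0) h1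
    (fun S x hx => h S.1 S.2 x hx) (mul_zero α)
    (fun x y hx hy => by rw [mul_add, hx, hy, add_zero])
  rwa [mul_one] at this

/-- Left multiplication by `n` on a left ideal `S` of the group algebra of the centralizer of `r`,
transported along `e` and extended by zero to all of `G`. -/
def leftIdealRep {r : G}
    (S : Submodule (MonoidAlgebra ℂ (Subgroup.centralizer {r}))
      (MonoidAlgebra ℂ (Subgroup.centralizer {r})))
    {W' : Type*} [AddCommGroup W'] [Module ℂ W'] (e : S ≃ₗ[ℂ] W') (n : G) : Module.End ℂ W' :=
  if hn : n ∈ Subgroup.centralizer {r} then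
    e.conj (Algebra.lsmul ℂ ℂ S (MonoidAlgebra.of ℂ (Subgroup.centralizer {r}) ⟨n, hn⟩))
  else 0

lemma mem_centralizer_singleton {r n : G} :
    n ∈ Subgroup.centralizer {r} ↔ n * r = r * n := by
  rw [Subgroup.mem_centralizer_singleton_iff]

lemma leftIdealRep_apply {r : G}
    (S : Submodule (MonoidAlgebra ℂ (Subgroup.centralizer {r}))
      (MonoidAlgebra ℂ (Subgroup.centralizer {r})))
    {W' : Type*} [AddCommGroup W'] [Module ℂ W'] (e : S ≃ₗ[ℂ] W') {n : G}
    (hn : n ∈ Subgroup.centralizer {r}) (w : W') :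
    leftIdealRep S e n w = e (MonoidAlgebra.of ℂ (Subgroup.centralizer {r}) ⟨n, hn⟩ • e.symm w) := by
  rw [leftIdealRep, dif_pos hn]
  rfl

lemma isCentralizerIrrep_leftIdealRep {r : G}
    (S : Submodule (MonoidAlgebra ℂ (Subgroup.centralizer {r}))
      (MonoidAlgebra ℂ (Subgroup.centralizer {r})))
    [IsSimpleModule (MonoidAlgebra ℂ (Subgroup.centralizer {r})) S]
    {W' : Type*} [AddCommGroup W'] [Module ℂ W'] (e : S ≃ₗ[ℂ] W') :
    IsCentralizerIrrep r (leftIdealRep S e) where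
  one := by
    ext w
    rw [leftIdealRep_apply S e (one_mem _)]
    change e (MonoidAlgebra.of ℂ (Subgroup.centralizer {r}) 1 • e.symm w) = w
    rw [map_one, one_smul, LinearEquiv.apply_symm_apply]
  mul m n hm hn := by
    ext w
    rw [← mem_centralizer_singleton] at hm hn
    rw [Module.End.mul_apply, leftIdealRep_apply S e (mul_mem hm hn), leftIdealRep_apply S e hm,
      leftIdealRep_apply S e hn, LinearEquiv.symm_apply_apply, smul_smul, ← map_mul]
    rfl
  irr U hU := by
    let U' : Submodule (MonoidAlgebra ℂ (Subgroup.centralizer {r})) S :=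
      { carrier := {s | e s ∈ U}
        zero_mem' := by simp
        add_mem' := fun {a b} ha hb => by
          simp only [Set.mem_ofPred_eq] at *
          rw [map_add]; exact U.add_mem ha hb
        smul_mem' := fun c s hs => by
          simp only [Set.mem_ofPred_eq] at *
          induction c using MonoidAlgebra.induction_on with
          | of m =>
            have := hU m (mem_centralizer_singleton.1 m.2) _ hs
            rwa [leftIdealRep_apply S e m.2, LinearEquiv.symm_apply_apply] at this
          | add x y hx hy => rw [add_smul, map_add]; exact U.add_mem hx hy
          | smul a x hx => rw [smul_assoc, map_smul]; exact U.smul_mem a hx }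
    have hmem : ∀ w, w ∈ U ↔ e.symm w ∈ U' := fun w => by
      change _ ↔ e (e.symm w) ∈ U
      rw [LinearEquiv.apply_symm_apply]
    rcases eq_bot_or_eq_top U' with h | h
    · left
      rw [Submodule.eq_bot_iff]
      intro w hw
      simpa [h] using (hmem w).1 hw
    · right
      rw [Submodule.eq_top_iff']
      intro w
      rw [hmem, h]; trivial

/-- A function on the centralizer annihilated by every irreducible representation vanishes. -/
lemma eq_zero_of_sum_smul_irrep_eq_zero (r : G) (a : G → ℂ)
    (h : ∀ (m : ℕ) (σ : G → Module.End ℂ (Fin m → ℂ)), IsCentralizerIrrep r σ →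
      ∑ n ∈ centralizerFinset r, a n • σ n = 0) :
    ∀ n ∈ centralizerFinset r, a n = 0 := by
  have hα : (∑ n : Subgroup.centralizer {r}, a n • MonoidAlgebra.of ℂ (Subgroup.centralizer {r}) n) = 0 := by
    refine MonoidAlgebra.eq_zero_of_smul_simple _ fun S hS s hs => ?_
    have : FiniteDimensional ℂ S :=
      inferInstanceAs (FiniteDimensional ℂ (S.restrictScalars ℂ))
    let e := (Module.finBasis ℂ S).equivFun
    have h0 := LinearMap.congr_fun (h _ _ (isCentralizerIrrep_leftIdealRep S e)) (e ⟨s, hs⟩)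
    have h1 : (∑ n ∈ centralizerFinset r, a n • leftIdealRep S e n) (e ⟨s, hs⟩) =
        e ((∑ n : Subgroup.centralizer {r}, a n • MonoidAlgebra.of ℂ (Subgroup.centralizer {r}) n) • ⟨s, hs⟩) := by
      rw [LinearMap.sum_apply, Finset.sum_smul, map_sum,
        Finset.sum_subtype (p := fun n => n ∈ Subgroup.centralizer {r}) (centralizerFinset r)
          (fun n => mem_centralizerFinset.trans mem_centralizer_singleton.symm)]
      refine Finset.sum_congr rfl fun n _ => ?_
      rw [LinearMap.smul_apply, leftIdealRep_apply S e n.2, LinearEquiv.symm_apply_apply,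
        smul_assoc, e.map_smul]
    rw [h1, LinearMap.zero_apply, LinearEquiv.map_eq_zero_iff] at h0
    exact congrArg Subtype.val h0
  intro n hn
  have hn' := mem_centralizer_singleton.2 (mem_centralizerFinset.1 hn)
  have := congrArg (fun x => x.coeff ⟨n, hn'⟩) hα
  simpa [MonoidAlgebra.coeff_sum, MonoidAlgebra.of_apply, Finsupp.single_apply] using this

end Completeness

section Blocks

variable {r : G} {q : G → G}

lemma conj_inv_site (hq : ∀ c, IsConj r c → q c * r * (q c)⁻¹ = c) {c d n : G}
    (hc : IsConj r c) (hd : IsConj r d) (hn : n ∈ centralizerFinset r) :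
    (q c * n * (q d)⁻¹)⁻¹ * c * (q c * n * (q d)⁻¹) = d := by
  rw [mem_centralizerFinset] at hn
  have h1 := hq c hc
  have h2 := hq d hd
  calc (q c * n * (q d)⁻¹)⁻¹ * c * (q c * n * (q d)⁻¹)
      = q d * n⁻¹ * ((q c)⁻¹ * c * q c) * n * (q d)⁻¹ := by group
    _ = q d * n⁻¹ * r * n * (q d)⁻¹ := by
      rw [show (q c)⁻¹ * c * q c = r by nth_rw 2 [← h1]; group]
    _ = q d * n⁻¹ * (r * n) * (q d)⁻¹ := by group
    _ = d := by rw [← hn]; nth_rw 3 [← h2]; group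

lemma zeta_mem_centralizerFinset (hq : ∀ c, IsConj r c → q c * r * (q c)⁻¹ = c) {c : G}
    (hc : IsConj r c) (h : G) :
    (q c)⁻¹ * h * q (h⁻¹ * c * h) ∈ centralizerFinset r := by
  rw [mem_centralizerFinset]
  have h1 := hq c hc
  have h2 := hq _ (isConj_conj_right hc h)
  calc (q c)⁻¹ * h * q (h⁻¹ * c * h) * r
      = (q c)⁻¹ * h * (q (h⁻¹ * c * h) * r * (q (h⁻¹ * c * h))⁻¹) * q (h⁻¹ * c * h) := by group
    _ = (q c)⁻¹ * c * h * q (h⁻¹ * c * h) := by rw [h2]; group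
    _ = (q c)⁻¹ * (q c * r * (q c)⁻¹) * h * q (h⁻¹ * c * h) := by rw [h1]
    _ = r * ((q c)⁻¹ * h * q (h⁻¹ * c * h)) := by group

/-- Every group element is `q_c n q_d⁻¹` for a unique `d` in the class of `r` and a unique `n` in
the centralizer of `r`. -/
lemma sum_eq_sum_conjCl (hq : ∀ c, IsConj r c → q c * r * (q c)⁻¹ = c) {M : Type*}
    [AddCommMonoid M] {c : G} (hc : IsConj r c) (f : G → M) :
    ∑ h : G, f h =
      ∑ d : ConjCl r, ∑ n ∈ centralizerFinset r, f (q c * n * (q d)⁻¹) := by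
  rw [← Finset.sum_product']
  symm
  refine Finset.sum_bij' (fun p _ => q c * p.2 * (q p.1)⁻¹)
    (fun h _ => (⟨h⁻¹ * c * h, isConj_conj_right hc h⟩, (q c)⁻¹ * h * q (h⁻¹ * c * h)))
    (fun _ _ => Finset.mem_univ _)
    (fun h _ => Finset.mem_product.2 ⟨Finset.mem_univ _, zeta_mem_centralizerFinset hq hc h⟩)
    ?_ (fun h _ => by simp only; group) (fun _ _ => rfl)
  rintro ⟨d, n⟩ hp
  have hd := conj_inv_site hq hc d.2 (Finset.mem_product.1 hp).2
  refine Prod.ext (Subtype.ext hd) ?_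
  simp only [hd]
  group

lemma rep_apply (hq : ∀ c, IsConj r c → q c * r * (q c)⁻¹ = c) (π : G → Module.End ℂ W)
    (x : DoubleDG G) (v : ConjCl r → W) (c : ConjCl r) :
    rep r q π x v c = ∑ d : ConjCl r, ∑ n ∈ centralizerFinset r,
      x (c, q c * n * (q d)⁻¹) • π n (v d) := by
  have h1 : rep r q π x v c = ∑ h : G, x (c, h) •
      π (zeta q (h⁻¹ * c * h) h) (v ⟨h⁻¹ * c * h, isConj_conj_right c.2 h⟩) := by
    simp only [rep, LinearMap.sum_apply, Finset.sum_apply, LinearMap.smul_apply, Pi.smul_apply]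
    rw [Finset.sum_eq_single (c : G)]
    · simp [siteAct]
    · intro s _ hs
      simp [siteAct, hs.symm]
    · simp
  rw [h1, sum_eq_sum_conjCl hq c.2]
  refine Finset.sum_congr rfl fun d _ => Finset.sum_congr rfl fun n hn => ?_
  have hd := conj_inv_site hq c.2 d.2 hn
  have hd' : (⟨_, isConj_conj_right c.2 (q c * n * (q d)⁻¹)⟩ : ConjCl r) = d := Subtype.ext hd
  have hz : zeta q d (q c * n * (q d)⁻¹) = n := by
    have : q c * n * (q d)⁻¹ * d * (q c * n * (q d)⁻¹)⁻¹ = c := by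
      nth_rw 2 [← hd]; group
    rw [zeta, this]; group
  rw [hd', hd, hz]

/-- The `(c, d)` matrix block of an operator on `ℂC ⊗ V_π`. -/
def siteBlock (L : Module.End ℂ (ConjCl r → W)) (c d : ConjCl r) : Module.End ℂ W :=
  LinearMap.proj c ∘ₗ L ∘ₗ LinearMap.single ℂ (fun _ : ConjCl r => W) d

lemma siteBlock_apply (L : Module.End ℂ (ConjCl r → W)) (c d : ConjCl r) (w : W) :
    siteBlock L c d w = L (Pi.single d w) c := rfl

lemma sum_siteBlock_apply (L : Module.End ℂ (ConjCl r → W)) (v : ConjCl r → W) (c : ConjCl r) :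
    ∑ d, siteBlock L c d (v d) = L v c := by
  simp only [siteBlock_apply]
  rw [← Finset.sum_apply, ← map_sum, LinearMap.sum_single_apply]

lemma siteBlock_mul (L L' : Module.End ℂ (ConjCl r → W)) (c d : ConjCl r) :
    siteBlock (L * L') c d = ∑ e, siteBlock L c e * siteBlock L' e d := by
  ext w
  simp only [LinearMap.sum_apply, Module.End.mul_apply]
  simp only [siteBlock_apply L', sum_siteBlock_apply]
  rfl

lemma siteBlock_ext {L L' : Module.End ℂ (ConjCl r → W)}
    (h : ∀ c d, siteBlock L c d = siteBlock L' c d) : L = L' := by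
  refine LinearMap.ext fun v => funext fun c => ?_
  rw [← sum_siteBlock_apply, ← sum_siteBlock_apply]
  simp only [h]

lemma siteBlock_rep (hq : ∀ c, IsConj r c → q c * r * (q c)⁻¹ = c) (π : G → Module.End ℂ W)
    (x : DoubleDG G) (c d : ConjCl r) :
    siteBlock (rep r q π x) c d =
      ∑ n ∈ centralizerFinset r, x (c, q c * n * (q d)⁻¹) • π n := by
  ext w
  rw [siteBlock_apply, rep_apply hq, Finset.sum_eq_single d]
  · simp [LinearMap.sum_apply]
  · intro e _ he
    simp [Pi.single_eq_of_ne he]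
  · simp

variable [FiniteDimensional ℂ W]

lemma PhiEnd_of_not_isConj (π : G → Module.End ℂ W) (L : Module.End ℂ (ConjCl r → W)) {c : G}
    (hc : ¬ IsConj r c) (h : G) : PhiEnd r q π L (c, h) = 0 := by
  rw [PhiEnd, Finset.sum_eq_zero, mul_zero]
  exact fun d _ => Finset.sum_eq_zero fun n _ => dif_neg fun h => hc h.1

lemma PhiEnd_apply (hq : ∀ c, IsConj r c → q c * r * (q c)⁻¹ = c) (π : G → Module.End ℂ W)
    (L : Module.End ℂ (ConjCl r → W)) (c d : ConjCl r) {n : G} (hn : n ∈ centralizerFinset r) :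
    PhiEnd r q π L (c, q c * n * (q d)⁻¹) =
      ((Module.finrank ℂ W : ℂ) / ((centralizerFinset r).card : ℂ)) *
        LinearMap.trace ℂ W (π n⁻¹ * siteBlock L c d) := by
  have huniq : ∀ d' n' : G, IsConj r d' → n' * r = r * n' →
      q c * n * (q d)⁻¹ = q c * n' * (q d')⁻¹ → d' = d := fun d' n' hd' hn' h => by
    rw [← conj_inv_site hq c.2 hd' (mem_centralizerFinset.2 hn'), ← h,
      conj_inv_site hq c.2 d.2 hn]
  rw [PhiEnd, centralizerFinset]
  congr 1
  rw [Finset.sum_eq_single (d : G), Finset.sum_eq_single n, dif_pos]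
  · change LinearMap.trace ℂ _ (LinearMap.single ℂ (fun _ : ConjCl r => W) d ∘ₗ
      (π n⁻¹ ∘ₗ LinearMap.proj c ∘ₗ L)) = _
    rw [LinearMap.trace_comp_comm']
    rfl
  · exact ⟨c.2, d.2, mem_centralizerFinset.1 hn, rfl⟩
  · intro n' _ hne
    refine dif_neg ?_
    rintro ⟨_, _, _, h⟩
    exact hne (mul_left_cancel (mul_right_cancel h)).symm
  · simp
  · intro d' _ hne
    refine Finset.sum_eq_zero fun n' _ => dif_neg ?_
    rintro ⟨_, hd', hn', h⟩
    exact hne (huniq d' n' hd' hn' h)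
  · simp

lemma doubleDG_ext {r : G} {q : G → G} (hq : ∀ c, IsConj r c → q c * r * (q c)⁻¹ = c)
    {x y : DoubleDG G} (h0 : ∀ c h, ¬ IsConj r c → x (c, h) = y (c, h))
    (h1 : ∀ c d : ConjCl r, ∀ n ∈ centralizerFinset r,
      x (c, q c * n * (q d)⁻¹) = y (c, q c * n * (q d)⁻¹)) : x = y := by
  funext ⟨c, h⟩
  by_cases hc : IsConj r c
  · have := h1 ⟨c, hc⟩ ⟨_, isConj_conj_right hc h⟩ _ (zeta_mem_centralizerFinset hq hc h)
    rwa [show q c * ((q c)⁻¹ * h * q (h⁻¹ * c * h)) * (q (h⁻¹ * c * h))⁻¹ = h by group] at this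
  · exact h0 c h hc

lemma PhiEnd_rep_mul (hq : ∀ c, IsConj r c → q c * r * (q c)⁻¹ = c) {π : G → Module.End ℂ W}
    (hπ : IsCentralizerIrrep r π) (x : DoubleDG G) (L : Module.End ℂ (ConjCl r → W)) :
    PhiEnd r q π (rep r q π x * L) = DGmul x (PhiEnd r q π L) := by
  refine doubleDG_ext hq (fun c h hc => ?_) fun c d n hn => ?_
  · rw [PhiEnd_of_not_isConj _ _ hc, DGmul]
    refine (Finset.sum_eq_zero fun k _ => ?_).symm
    rw [PhiEnd_of_not_isConj, mul_zero]
    intro hk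
    refine hc ?_
    have := isConj_conj_right hk k⁻¹
    rwa [show k⁻¹⁻¹ * (k⁻¹ * c * k) * k⁻¹ = c by group] at this
  · rw [PhiEnd_apply hq _ _ _ _ hn, siteBlock_mul, DGmul, sum_eq_sum_conjCl hq c.2,
      Finset.mul_sum, map_sum, Finset.mul_sum]
    refine Finset.sum_congr rfl fun e _ => ?_
    rw [siteBlock_rep hq, Finset.sum_mul, Finset.mul_sum, map_sum, Finset.mul_sum]
    refine Finset.sum_congr rfl fun m hm => ?_
    have hmn := mul_mem_centralizerFinset (inv_mem_centralizerFinset hm) hn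
    have key := PhiEnd_apply hq π L e d hmn
    simp only [conj_inv_site hq c.2 e.2 hm]
    rw [show (q c * m * (q e)⁻¹)⁻¹ * (q c * n * (q d)⁻¹) = q e * (m⁻¹ * n) * (q d)⁻¹ by group,
      key, mul_inv_rev, inv_inv, hπ.mul _ _
        (mem_centralizerFinset.1 (inv_mem_centralizerFinset hn)) (mem_centralizerFinset.1 hm),
      smul_mul_assoc, mul_smul_comm, map_smul, smul_eq_mul, mul_assoc (π n⁻¹)]
    ring

lemma PhiEnd_mul_rep (hq : ∀ c, IsConj r c → q c * r * (q c)⁻¹ = c) {π : G → Module.End ℂ W}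
    (hπ : IsCentralizerIrrep r π) (x : DoubleDG G) (L : Module.End ℂ (ConjCl r → W)) :
    PhiEnd r q π (L * rep r q π x) = DGmul (PhiEnd r q π L) x := by
  refine doubleDG_ext hq (fun c h hc => ?_) fun c d n hn => ?_
  · rw [PhiEnd_of_not_isConj _ _ hc, DGmul]
    refine (Finset.sum_eq_zero fun k _ => ?_).symm
    rw [PhiEnd_of_not_isConj _ _ hc, zero_mul]
  · rw [PhiEnd_apply hq _ _ _ _ hn, siteBlock_mul, DGmul, sum_eq_sum_conjCl hq c.2,
      Finset.mul_sum, map_sum, Finset.mul_sum]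
    refine Finset.sum_congr rfl fun e _ => ?_
    rw [siteBlock_rep hq, Finset.mul_sum, Finset.mul_sum, map_sum, Finset.mul_sum]
    symm
    rw [← sum_centralizerFinset_mul_left hn, ← sum_centralizerFinset_inv]
    refine Finset.sum_congr rfl fun m hm => ?_
    have hnm := mul_mem_centralizerFinset hn (inv_mem_centralizerFinset hm)
    rw [conj_inv_site hq c.2 e.2 hnm, PhiEnd_apply hq π L c e hnm,
      show (q c * (n * m⁻¹) * (q e)⁻¹)⁻¹ * (q c * n * (q d)⁻¹) = q e * m * (q d)⁻¹ by group,
      mul_inv_rev, inv_inv, hπ.mul _ _ (mem_centralizerFinset.1 hm)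
        (mem_centralizerFinset.1 (inv_mem_centralizerFinset hn)),
      mul_smul_comm, mul_smul_comm, map_smul, smul_eq_mul, mul_assoc (π m),
      LinearMap.trace_mul_comm ℂ (π m), mul_assoc (π n⁻¹)]
    ring

lemma siteBlock_eq_sum_PhiEnd (hq : ∀ c, IsConj r c → q c * r * (q c)⁻¹ = c)
    {π : G → Module.End ℂ W} (hπ : IsCentralizerIrrep r π)
    (L : Module.End ℂ (ConjCl r → W)) (c d : ConjCl r) :
    ∑ n ∈ centralizerFinset r, PhiEnd r q π L (c, q c * n * (q d)⁻¹) • π n =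
      siteBlock L c d := by
  conv_rhs => rw [← hπ.sum_trace_smul_eq (siteBlock L c d), Finset.smul_sum]
  refine Finset.sum_congr rfl fun n hn => ?_
  rw [PhiEnd_apply hq _ _ _ _ hn, mul_smul]

/-- Non-isomorphic irreducible representations of the same centralizer are orthogonal. -/
lemma sum_PhiEnd_smul_eq_zero {W' : Type*} [AddCommGroup W'] [Module ℂ W']
    (hq : ∀ c, IsConj r c → q c * r * (q c)⁻¹ = c) {π : G → Module.End ℂ W}
    {ρ : G → Module.End ℂ W'} (hπ : IsCentralizerIrrep r π) (hρ : IsCentralizerIrrep r ρ)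
    (hne : ¬ ∃ f : W ≃ₗ[ℂ] W', ∀ n : G, n * r = r * n → ∀ w, f (π n w) = ρ n (f w))
    (L : Module.End ℂ (ConjCl r → W)) (c d : ConjCl r) :
    ∑ n ∈ centralizerFinset r, PhiEnd r q π L (c, q c * n * (q d)⁻¹) • ρ n = 0 := by
  rw [← smul_zero ((Module.finrank ℂ W : ℂ) / ((centralizerFinset r).card : ℂ)),
    ← hπ.sum_trace_smul_eq_zero hρ hne (siteBlock L c d), Finset.smul_sum]
  refine Finset.sum_congr rfl fun n hn => ?_
  rw [PhiEnd_apply hq _ _ _ _ hn, mul_smul]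

lemma PhiEnd_add (π : G → Module.End ℂ W) (L L' : Module.End ℂ (ConjCl r → W)) :
    PhiEnd r q π (L + L') = PhiEnd r q π L + PhiEnd r q π L' := by
  funext p
  simp only [PhiEnd, Pi.add_apply]
  rw [← mul_add, ← Finset.sum_add_distrib]
  simp_rw [← Finset.sum_add_distrib]
  congr! 4 with d _ n _
  split_ifs
  · simp only [LinearMap.comp_add, map_add]
  · simp

lemma PhiEnd_smul (π : G → Module.End ℂ W) (a : ℂ) (L : Module.End ℂ (ConjCl r → W)) :
    PhiEnd r q π (a • L) = a • PhiEnd r q π L := by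
  funext p
  simp only [PhiEnd, Pi.smul_apply, smul_eq_mul]
  rw [mul_left_comm a, Finset.mul_sum _ _ a]
  congr 1
  refine Finset.sum_congr rfl fun d _ => ?_
  rw [Finset.mul_sum]
  refine Finset.sum_congr rfl fun n _ => ?_
  split_ifs
  · simp only [LinearMap.comp_smul, map_smul, smul_eq_mul]
  · simp

end Blocks

lemma DGmul_sum_right {ι : Type*} [Fintype ι] (x : DoubleDG G) (y : ι → DoubleDG G) :
    DGmul x (∑ i, y i) = ∑ i, DGmul x (y i) := by
  funext p
  simp only [DGmul, Finset.sum_apply, Finset.mul_sum]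
  exact Finset.sum_comm

lemma DGmul_sum_left {ι : Type*} [Fintype ι] (x : ι → DoubleDG G) (y : DoubleDG G) :
    DGmul (∑ i, x i) y = ∑ i, DGmul (x i) y := by
  funext p
  simp only [DGmul, Finset.sum_apply, Finset.sum_mul]
  exact Finset.sum_comm

lemma rep_add (r : G) (q : G → G) (π : G → Module.End ℂ W) (x y : DoubleDG G) :
    rep r q π (x + y) = rep r q π x + rep r q π y := by
  simp [rep, add_smul, Finset.sum_add_distrib]

lemma rep_sub (r : G) (q : G → G) (π : G → Module.End ℂ W) (x y : DoubleDG G) :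
    rep r q π (x - y) = rep r q π x - rep r q π y := by
  rw [eq_sub_iff_add_eq, ← rep_add, sub_add_cancel]

/-- Statement: indexing the pairs `(C, π)` by a finite type `ι` as in the Peter–Weyl
decomposition, the map `Φ : ⊕_i End(V_i) → D(G)` is a `ℂ`-linear bijection
intertwining the left and right multiplications of `D(G)` with the left and right
actions on each `End(V_{C,π})`; i.e. it is an isomorphism of `D(G)`-bimodules. -/
theorem statement6
    {ι : Type} [Fintype ι]
    (κ : ι → G)
    (q : ι → G → G)
    (Wf : ι → Type) [∀ i, AddCommGroup (Wf i)] [∀ i, Module ℂ (Wf i)]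
    [∀ i, FiniteDimensional ℂ (Wf i)]
    (π : ∀ i, G → Module.End ℂ (Wf i))
    (hq : ∀ i c, IsConj (κ i) c → q i c * κ i * (q i c)⁻¹ = c)
    (hπ1 : ∀ i, π i 1 = 1)
    (hπmul : ∀ i, ∀ m n : G, m * κ i = κ i * m → n * κ i = κ i * n →
      π i (m * n) = π i m * π i n)
    (hirr : ∀ i, ∀ U : Submodule ℂ (Wf i),
      (∀ n : G, n * κ i = κ i * n → ∀ w ∈ U, π i n w ∈ U) → U = ⊥ ∨ U = ⊤)
    (hbase : ∀ i j, IsConj (κ i) (κ j) → κ i = κ j ∧ q i = q j)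
    (hdistinct : ∀ i j, i ≠ j → κ i = κ j →
      ¬ ∃ f : Wf i ≃ₗ[ℂ] Wf j, ∀ n : G, n * κ i = κ i * n →
        ∀ w : Wf i, f (π i n w) = π j n (f w))
    (hclass : ∀ g : G, ∃ i, IsConj (κ i) g)
    (hcomplete : ∀ i, ∀ (W' : Type) [AddCommGroup W'] [Module ℂ W']
      [FiniteDimensional ℂ W'], ∀ σ : G → Module.End ℂ W',
      σ 1 = 1 →
      (∀ m n : G, m * κ i = κ i * m → n * κ i = κ i * n → σ (m * n) = σ m * σ n) →
      (∀ U : Submodule ℂ W',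
        (∀ n : G, n * κ i = κ i * n → ∀ w ∈ U, σ n w ∈ U) → U = ⊥ ∨ U = ⊤) →
      ∃ j, κ j = κ i ∧ ∃ f : W' ≃ₗ[ℂ] Wf j, ∀ n : G, n * κ i = κ i * n →
        ∀ w : W', f (σ n w) = π j n (f w)) :
    -- the total Peter–Weyl map
    (∀ E E' : ∀ i, Module.End ℂ (ConjCl (κ i) → Wf i),
      (∑ i : ι, PhiEnd (κ i) (q i) (π i) ((E + E') i)) =
        (∑ i : ι, PhiEnd (κ i) (q i) (π i) (E i)) +
          (∑ i : ι, PhiEnd (κ i) (q i) (π i) (E' i))) ∧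
    (∀ (a : ℂ) (E : ∀ i, Module.End ℂ (ConjCl (κ i) → Wf i)),
      (∑ i : ι, PhiEnd (κ i) (q i) (π i) ((a • E) i)) =
        a • ∑ i : ι, PhiEnd (κ i) (q i) (π i) (E i)) ∧
    Function.Bijective
      (fun E : ∀ i, Module.End ℂ (ConjCl (κ i) → Wf i) =>
        ∑ i : ι, PhiEnd (κ i) (q i) (π i) (E i)) ∧
    (∀ (x : DoubleDG G) (E : ∀ i, Module.End ℂ (ConjCl (κ i) → Wf i)),
      (∑ i : ι, PhiEnd (κ i) (q i) (π i) (rep (κ i) (q i) (π i) x * E i)) =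
        DGmul x (∑ i : ι, PhiEnd (κ i) (q i) (π i) (E i))) ∧
    (∀ (x : DoubleDG G) (E : ∀ i, Module.End ℂ (ConjCl (κ i) → Wf i)),
      (∑ i : ι, PhiEnd (κ i) (q i) (π i) (E i * rep (κ i) (q i) (π i) x)) =
        DGmul (∑ i : ι, PhiEnd (κ i) (q i) (π i) (E i)) x) := by
  have hπ : ∀ i, IsCentralizerIrrep (κ i) (π i) := fun i => ⟨hπ1 i, hπmul i, hirr i⟩
  have hleft : ∀ E : ∀ i, Module.End ℂ (ConjCl (κ i) → Wf i), ∀ k,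
      rep (κ k) (q k) (π k) (∑ i : ι, PhiEnd (κ i) (q i) (π i) (E i)) = E k := by
    intro E k
    refine siteBlock_ext fun c d => ?_
    rw [siteBlock_rep (hq k)]
    simp only [Finset.sum_apply, Finset.sum_smul]
    rw [Finset.sum_comm, Finset.sum_eq_single k]
    · exact siteBlock_eq_sum_PhiEnd (hq k) (hπ k) (E k) c d
    · intro j _ hjk
      by_cases hconj : IsConj (κ j) (κ k)
      · obtain ⟨hκ, hqq⟩ := hbase j k hconj
        obtain ⟨c, hc⟩ := c
        obtain ⟨d, hd⟩ := d
        have hcj : IsConj (κ j) c := by rwa [hκ]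
        have hdj : IsConj (κ j) d := by rwa [hκ]
        simp only
        rw [← hqq, ← hκ]
        exact sum_PhiEnd_smul_eq_zero (hq j) (hπ j) (hκ ▸ hπ k) (hdistinct j k hjk hκ) (E j)
          ⟨c, hcj⟩ ⟨d, hdj⟩
      · refine Finset.sum_eq_zero fun n _ => ?_
        rw [PhiEnd_of_not_isConj _ _ fun h => hconj (h.trans c.2.symm), zero_smul]
    · simp
  have hinj : ∀ x : DoubleDG G, (∀ k, rep (κ k) (q k) (π k) x = 0) → x = 0 := by
    intro x hx
    funext ⟨c, h⟩
    obtain ⟨i, hi⟩ := hclass c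
    have hzero := eq_zero_of_sum_smul_irrep_eq_zero (κ i)
      (fun n => x (c, q i c * n * (q i (h⁻¹ * c * h))⁻¹)) fun m σ hσ => by
        obtain ⟨j, hj, f, hf⟩ := hcomplete i (Fin m → ℂ) σ hσ.one hσ.mul hσ.irr
        have hqj : q j = q i := (hbase j i (hj ▸ IsConj.refl _)).2
        have hcj : IsConj (κ j) c := hj ▸ hi
        have hb := siteBlock_rep (hq j) (π j) x ⟨c, hcj⟩ ⟨_, isConj_conj_right hcj h⟩
        rw [hx j] at hb
        simp only at hb
        rw [hqj] at hb
        rw [← hj]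
        refine LinearMap.ext fun w => f.injective ?_
        have hw := LinearMap.congr_fun hb (f w)
        rw [LinearMap.zero_apply, map_zero]
        simp only [LinearMap.sum_apply, LinearMap.smul_apply, map_sum, map_smul] at hw ⊢
        refine Eq.trans (Finset.sum_congr rfl fun n hn => ?_) hw.symm
        rw [hf n (hj ▸ mem_centralizerFinset.1 hn)]
    have := hzero _ (zeta_mem_centralizerFinset (hq i) hi h)
    simpa [mul_assoc] using this
  refine ⟨fun E E' => ?_, fun a E => ?_, ⟨fun E E' h => ?_, fun x => ?_⟩, fun x E => ?_,
    fun x E => ?_⟩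
  · simp only [Pi.add_apply, PhiEnd_add, Finset.sum_add_distrib]
  · simp only [Pi.smul_apply, PhiEnd_smul, Finset.smul_sum]
  · funext k
    rw [← hleft E k, ← hleft E' k]
    exact congrArg _ h
  · refine ⟨fun i => rep (κ i) (q i) (π i) x, sub_eq_zero.1 (hinj _ fun k => ?_)⟩
    rw [rep_sub, hleft, sub_self]
  · rw [DGmul_sum_right]
    exact Finset.sum_congr rfl fun i _ => PhiEnd_rep_mul (hq i) (hπ i) x (E i)
  · rw [DGmul_sum_left]
    exact Finset.sum_congr rfl fun i _ => PhiEnd_mul_rep (hq i) (hπ i) x (E i)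

end
end

section
/- The vertex operator A := (1/|G|) Σ_{h∈G} (h ▷) and the face operator B := δ_e ▷ on V satisfy A² = A, B² = B, and A ∘ B = B ∘ A. -/
/-!
The vertex operator `A = (1/|G|) Σ_h (h ▷)` and the face operator `B = δ_e ▷` at a site
of the Kitaev `D(G)` model are commuting projectors.
-/

noncomputable section

open scoped BigOperators

/-- The state space at the site `(v,p)`: basis vectors `|x_a,…,x_f⟩` record group
elements on the six arrows `a,…,f` around the site (indexed `0,…,5`). -/
abbrev SiteV (G : Type*) := (Fin 6 → G) → ℂ

variable {G : Type*} [Group G] [Fintype G] [DecidableEq G]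

/-- The vertex action `h ▷ |x_a,…,x_f⟩ = |h x_a, x_b h⁻¹, x_c h⁻¹, h x_d, x_e, x_f⟩`. -/
def vertexAct (h : G) : Module.End ℂ (SiteV G) where
  toFun v := fun y => v ![h⁻¹ * y 0, y 1 * h, y 2 * h, h⁻¹ * y 3, y 4, y 5]
  map_add' _ _ := rfl
  map_smul' _ _ := rfl

/-- The face action `δ_g ▷ |x_a,…,x_f⟩ = [x_a x_f x_e⁻¹ x_d⁻¹ = g] |x_a,…,x_f⟩`. -/
def faceAct (g : G) : Module.End ℂ (SiteV G) where
  toFun v := fun y => if y 0 * y 5 * (y 4)⁻¹ * (y 3)⁻¹ = g then v y else 0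
  map_add' v w := by
    funext y
    by_cases h : y 0 * y 5 * (y 4)⁻¹ * (y 3)⁻¹ = g <;> simp [h]
  map_smul' a v := by
    funext y
    by_cases h : y 0 * y 5 * (y 4)⁻¹ * (y 3)⁻¹ = g <;> simp [h]

theorem vertexAct_mul {H : Type*} [Group H] (h k : H) :
    vertexAct h * vertexAct k = vertexAct (h * k) := by
  refine LinearMap.ext fun v => funext fun y => ?_
  simp [vertexAct, mul_assoc]

theorem faceAct_mul_self {H : Type*} [Group H] [DecidableEq H] (g : H) :
    faceAct g * faceAct g = faceAct g := by
  refine LinearMap.ext fun v => funext fun y => ?_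
  simp only [faceAct, Module.End.mul_apply, LinearMap.coe_mk, AddHom.coe_mk]
  split_ifs <;> rfl

theorem vertexAct_mul_faceAct {H : Type*} [Group H] [DecidableEq H] (h g : H) :
    vertexAct h * faceAct g = faceAct (h * g * h⁻¹) * vertexAct h := by
  refine LinearMap.ext fun v => funext fun y => ?_
  have hol : h⁻¹ * y 0 * y 5 * (y 4)⁻¹ * (h⁻¹ * y 3)⁻¹ = g ↔
      y 0 * y 5 * (y 4)⁻¹ * (y 3)⁻¹ = h * g * h⁻¹ := by
    rw [eq_mul_inv_iff_mul_eq, ← inv_mul_eq_iff_eq_mul]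
    simp [mul_assoc]
  exact if_congr hol rfl rfl

theorem sum_vertexAct_mul_sum_vertexAct {H : Type*} [Group H] [Fintype H] :
    (∑ h : H, vertexAct h) * ∑ h : H, vertexAct h =
      (Fintype.card H : ℂ) • ∑ h : H, vertexAct h := by
  have shift (h : H) : ∑ k : H, vertexAct (h * k) = ∑ k : H, vertexAct k :=
    Equiv.sum_comp (Equiv.mulLeft h) vertexAct
  simp only [Finset.sum_mul_sum, vertexAct_mul, shift, Finset.sum_const, Finset.card_univ,
    Nat.cast_smul_eq_nsmul]

/-- `A := (1/|G|) Σ_{h∈G} (h ▷)` and `B := δ_e ▷` satisfy `A² = A`, `B² = B` and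
`A ∘ B = B ∘ A`. -/
theorem statement9 :
    ((Fintype.card G : ℂ)⁻¹ • ∑ h : G, vertexAct h) *
        ((Fintype.card G : ℂ)⁻¹ • ∑ h : G, vertexAct h) =
      (Fintype.card G : ℂ)⁻¹ • ∑ h : G, vertexAct h ∧
    faceAct (1 : G) * faceAct (1 : G) = faceAct (1 : G) ∧
    ((Fintype.card G : ℂ)⁻¹ • ∑ h : G, vertexAct h) * faceAct (1 : G) =
      faceAct (1 : G) * ((Fintype.card G : ℂ)⁻¹ • ∑ h : G, vertexAct h) := by
  refine ⟨?_, faceAct_mul_self 1, ?_⟩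
  · have hcard : (Fintype.card G : ℂ) ≠ 0 := Nat.cast_ne_zero.mpr Fintype.card_ne_zero
    rw [smul_mul_smul_comm, sum_vertexAct_mul_sum_vertexAct, smul_smul,
      inv_mul_cancel_right₀ hcard]
  · simp only [smul_mul_assoc, mul_smul_comm, Finset.sum_mul, Finset.mul_sum,
      vertexAct_mul_faceAct, mul_one, mul_inv_cancel]

end
end
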